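/- arXiv:1605.08084 — 5 statements merged into one kernel-verified Lean document; each statement's English description precedes it below -/
import Mathlib

section
/- Let T > 0 and let u : [0,T) × ℝ → ℝ be continuous, continuously differentiable in the spatial variable x, with u and ∂_x u bounded on [0,t'] × ℝ for every t' < T. Then there exists a unique function φ ∈ C^1([0,T) × ℝ, ℝ) satisfying ∂_t φ(t,x) = u(t, φ(t,x)) and φ(0,x) = x for all (t,x) ∈ [0,T) × ℝ. Moreover, for all (t,x) ∈ [0,T) × ℝ one has ∂_x φ(t,x) = exp(∫₀^t ∂_x u(s, φ(s,x)) ds) > 0, and for each fixed t ∈ [0,T) the map x ↦ φ(t,x) is a strictly increasing bijection (diffeomorphism) of ℝ onto ℝ. -/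
open Set Filter Topology

lemma aux_lip {T : ℝ} {u ux : ℝ → ℝ → ℝ}
    (hux : ∀ t ∈ Set.Ico (0 : ℝ) T, ∀ x : ℝ, HasDerivAt (u t) (ux t x) x)
    {b : ℝ} (hb : b ∈ Ico 0 T) {M : NNReal}
    (hM : ∀ t ∈ Set.Icc (0 : ℝ) b, ∀ x : ℝ, |u t x| ≤ M ∧ |ux t x| ≤ M) :
    ∀ t ∈ Icc 0 b, LipschitzWith M (u t) := by
  intro t ht
  have h : ∀ x, HasDerivAt (u t) (ux t x) x := hux t ⟨ht.1, ht.2.trans_lt hb.2⟩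
  apply lipschitzWith_of_nnnorm_deriv_le (fun x => (h x).differentiableAt)
  intro x
  rw [(h x).deriv, ← NNReal.coe_le_coe]
  simpa using (hM t ht x).2

lemma aux_right {T : ℝ} {f : ℝ → ℝ} {f' t : ℝ} (ht : t ∈ Ico 0 T)
    (h : HasDerivWithinAt f f' (Ico 0 T) t) : HasDerivWithinAt f f' (Ici t) t :=
  h.mono_of_mem_nhdsWithin (mem_of_superset (Ico_mem_nhdsGE ht.2)
    (fun _ hs => ⟨ht.1.trans hs.1, hs.2⟩))

/-- solutions stay exponentially close -/
lemma aux_dist {T : ℝ} {u ux : ℝ → ℝ → ℝ}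
    (hux : ∀ t ∈ Set.Ico (0 : ℝ) T, ∀ x : ℝ, HasDerivAt (u t) (ux t x) x)
    {b : ℝ} (hb : b ∈ Ico 0 T) {M : NNReal}
    (hM : ∀ t ∈ Set.Icc (0 : ℝ) b, ∀ x : ℝ, |u t x| ≤ M ∧ |ux t x| ≤ M)
    {f g : ℝ → ℝ}
    (hf : ∀ t ∈ Icc 0 b, HasDerivWithinAt f (u t (f t)) (Icc 0 b) t)
    (hg : ∀ t ∈ Icc 0 b, HasDerivWithinAt g (u t (g t)) (Icc 0 b) t) :
    ∀ t ∈ Icc 0 b, dist (f t) (g t) ≤ dist (f 0) (g 0) * Real.exp (M * (t - 0)) := by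
  have key : ∀ f : ℝ → ℝ, (∀ t ∈ Icc 0 b, HasDerivWithinAt f (u t (f t)) (Icc 0 b) t) →
      ∀ t ∈ Ico 0 b, HasDerivWithinAt f (u t (f t)) (Ici t) t := fun f hf t ht =>
    (hf t ⟨ht.1, ht.2.le⟩).mono_of_mem_nhdsWithin (mem_of_superset (Ico_mem_nhdsGE ht.2)
      (fun _ hs => ⟨ht.1.trans hs.1, hs.2.le⟩))
  exact dist_le_of_trajectories_ODE_of_mem (v := u) (s := fun _ => univ)
    (fun t ht => (aux_lip hux hb hM t ⟨ht.1, ht.2.le⟩).lipschitzOnWith)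
    (fun t ht => (hf t ht).continuousWithinAt) (key f hf) (fun _ _ => trivial)
    (fun t ht => (hg t ht).continuousWithinAt) (key g hg) (fun _ _ => trivial) le_rfl

lemma aux_exist {T : ℝ} {u ux : ℝ → ℝ → ℝ}
    (hu_cont : ContinuousOn (fun q : ℝ × ℝ => u q.1 q.2)
      (Set.Ico 0 T ×ˢ (Set.univ : Set ℝ)))
    (hux : ∀ t ∈ Set.Ico (0 : ℝ) T, ∀ x : ℝ, HasDerivAt (u t) (ux t x) x)
    {b : ℝ} (hb : b ∈ Ico 0 T) {M : NNReal}
    (hM : ∀ t ∈ Set.Icc (0 : ℝ) b, ∀ x : ℝ, |u t x| ≤ M ∧ |ux t x| ≤ M) (x : ℝ) :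
    ∃ α : ℝ → ℝ, α 0 = x ∧ ∀ t ∈ Icc 0 b, HasDerivWithinAt α (u t (α t)) (Icc 0 b) t := by
  have hp : IsPicardLindelof u (tmin := 0) (tmax := b) ⟨0, le_rfl, hb.1⟩ x
      (M * b.toNNReal) 0 M M := by
    refine ⟨fun t ht => (aux_lip hux hb hM t ht).lipschitzOnWith, ?_, ?_, ?_⟩
    · intro y _
      exact hu_cont.comp (f := fun t => (t, y)) (by fun_prop)
        (fun t ht => ⟨⟨ht.1, ht.2.trans_lt hb.2⟩, trivial⟩)
    · intro t ht y _
      exact (hM t ht y).1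
    · simp [hb.1, Real.coe_toNNReal b hb.1]
  exact hp.exists_eq_forall_mem_Icc_hasDerivWithinAt₀

lemma aux_glue {T : ℝ} {u ux : ℝ → ℝ → ℝ}
    (hu_cont : ContinuousOn (fun q : ℝ × ℝ => u q.1 q.2)
      (Set.Ico 0 T ×ˢ (Set.univ : Set ℝ)))
    (hux : ∀ t ∈ Set.Ico (0 : ℝ) T, ∀ x : ℝ, HasDerivAt (u t) (ux t x) x)
    (hbdd : ∀ t' ∈ Set.Ico (0 : ℝ) T, ∃ M : NNReal,
      ∀ t ∈ Set.Icc (0 : ℝ) t', ∀ x : ℝ, |u t x| ≤ M ∧ |ux t x| ≤ M) (hT : 0 < T) :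
    ∃ φ : ℝ → ℝ → ℝ, (∀ x : ℝ, φ 0 x = x) ∧
        (∀ t ∈ Set.Ico (0 : ℝ) T, ∀ x : ℝ,
          HasDerivWithinAt (fun s => φ s x) (u t (φ t x)) (Set.Ico 0 T) t) := by
  have h1 : ∀ b x : ℝ, ∃ α : ℝ → ℝ, b ∈ Ico 0 T → (α 0 = x ∧
      ∀ t ∈ Icc 0 b, HasDerivWithinAt α (u t (α t)) (Icc 0 b) t) := by
    intro b x
    by_cases hb : b ∈ Ico 0 T
    · obtain ⟨M, hM⟩ := hbdd b hb
      obtain ⟨α, hα⟩ := aux_exist hu_cont hux hb hM x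
      exact ⟨α, fun _ => hα⟩
    · exact ⟨0, fun h => absurd h hb⟩
  choose α hα using h1
  have hcons : ∀ b ∈ Ico 0 T, ∀ c ∈ Ico 0 T, b ≤ c → ∀ x, ∀ t ∈ Icc 0 b, α b x t = α c x t := by
    intro b hb c hc hbc x t ht
    obtain ⟨M, hM⟩ := hbdd b hb
    have := aux_dist hux hb hM (hα b x hb).2 (g := α c x)
      (fun t ht => ((hα c x hc).2 t ⟨ht.1, ht.2.trans hbc⟩).mono (Icc_subset_Icc_right hbc)) t ht
    rw [(hα b x hb).1, (hα c x hc).1, dist_self, zero_mul] at this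
    exact dist_le_zero.1 this
  have hmid : ∀ t ∈ Ico 0 T, (t + T) / 2 ∈ Ico 0 T := fun t ht =>
    ⟨by linarith [ht.1, ht.2], by linarith [ht.2]⟩
  have hcons' : ∀ b ∈ Ico 0 T, ∀ x, ∀ t ∈ Icc 0 b, α ((t + T) / 2) x t = α b x t := by
    intro b hb x t ht
    have htT : t ∈ Ico 0 T := ⟨ht.1, ht.2.trans_lt hb.2⟩
    rcases le_total b ((t + T) / 2) with h | h
    · exact (hcons b hb _ (hmid t htT) h x t ht).symm
    · exact hcons _ (hmid t htT) b hb h x t ⟨ht.1, by linarith [htT.2]⟩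
  refine ⟨fun t x => α ((t + T) / 2) x t, fun x => (hα _ x (hmid 0 ⟨le_rfl, hT⟩)).1, ?_⟩
  intro t ht x
  set b := (t + T) / 2 with hbdef
  have hb : b ∈ Ico 0 T := hmid t ht
  have htb : t < b := by linarith [ht.2]
  have h := (hα b x hb).2 t ⟨ht.1, htb.le⟩
  have hmem : Icc 0 b ∈ 𝓝[Ico 0 T] t := by
    filter_upwards [self_mem_nhdsWithin, mem_nhdsWithin_of_mem_nhds (Iio_mem_nhds htb)] with s h1 h2
    exact ⟨h1.1, le_of_lt h2⟩
  refine (h.mono_of_mem_nhdsWithin hmem).congr_of_eventuallyEq ?_ rfl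
  filter_upwards [hmem] with s hs
  exact hcons' b hb x s hs

lemma aux_cont {T : ℝ} {u ux : ℝ → ℝ → ℝ}
    (hux : ∀ t ∈ Set.Ico (0 : ℝ) T, ∀ x : ℝ, HasDerivAt (u t) (ux t x) x)
    {b : ℝ} (hb : b ∈ Ico 0 T) {M : NNReal}
    (hM : ∀ t ∈ Set.Icc (0 : ℝ) b, ∀ x : ℝ, |u t x| ≤ M ∧ |ux t x| ≤ M)
    {φ : ℝ → ℝ → ℝ} (h0 : ∀ x, φ 0 x = x)
    (hφ : ∀ t ∈ Set.Ico (0 : ℝ) T, ∀ x : ℝ,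
          HasDerivWithinAt (fun s => φ s x) (u t (φ t x)) (Set.Ico 0 T) t) :
    ContinuousOn (fun q : ℝ × ℝ => φ q.1 q.2) (Icc 0 b ×ˢ univ) := by
  have hsub : Icc 0 b ⊆ Ico 0 T := fun s hs => ⟨hs.1, hs.2.trans_lt hb.2⟩
  apply continuousOn_prod_of_continuousOn_lipschitzOnWith' (f := fun q : ℝ × ℝ => φ q.1 q.2)
    (Real.exp (M * b)).toNNReal
  · intro t ht
    apply LipschitzOnWith.of_dist_le_mul
    intro x _ y _
    have := aux_dist hux hb hM (f := fun s => φ s x) (g := fun s => φ s y)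
      (fun t ht => (hφ t (hsub ht) x).mono hsub) (fun t ht => (hφ t (hsub ht) y).mono hsub) t ht
    simp only [h0] at this
    refine this.trans ?_
    rw [mul_comm]
    rw [Real.coe_toNNReal _ (Real.exp_pos _).le, sub_zero]
    have := ht.2
    gcongr
  · intro x _ t ht
    exact ((hφ t (hsub ht) x).mono hsub).continuousWithinAt

lemma aux_core {T : ℝ} {u ux : ℝ → ℝ → ℝ}
    (hux_cont : ContinuousOn (fun q : ℝ × ℝ => ux q.1 q.2)
      (Set.Ico 0 T ×ˢ (Set.univ : Set ℝ)))
    (hux : ∀ t ∈ Set.Ico (0 : ℝ) T, ∀ x : ℝ, HasDerivAt (u t) (ux t x) x)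
    {b : ℝ} (hb : b ∈ Ico 0 T) 
    {φ : ℝ → ℝ → ℝ} (h0 : ∀ x, φ 0 x = x)
    (hφ : ∀ t ∈ Set.Ico (0 : ℝ) T, ∀ x : ℝ,
          HasDerivWithinAt (fun s => φ s x) (u t (φ t x)) (Set.Ico 0 T) t)
    (hc : ContinuousOn (fun q : ℝ × ℝ => φ q.1 q.2) (Icc 0 b ×ˢ univ)) :
    ∃ E : ℝ × ℝ × ℝ → ℝ, Continuous E ∧ (∀ p, 0 < E p) ∧ ∀ t ∈ Icc 0 b,
      (∀ x, E (t, x, x) = Real.exp (∫ s in (0 : ℝ)..t, ux s (φ s x))) ∧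
      ∀ x y, φ t y - φ t x = (y - x) * E (t, x, y) := by
  have hsub : Icc 0 b ⊆ Ico 0 T := fun s hs => ⟨hs.1, hs.2.trans_lt hb.2⟩
  set c : ℝ → ℝ := fun s => projIcc 0 b hb.1 s with hcdef
  have hcc : Continuous c := continuous_subtype_val.comp continuous_projIcc
  have hcm : ∀ s, c s ∈ Icc 0 b := fun s => (projIcc 0 b hb.1 s).2
  have hce : ∀ s ∈ Icc 0 b, c s = s := fun s hs => by simp [hcdef, projIcc_of_mem hb.1 hs]
  have hW : Continuous (fun q : ℝ × ℝ => ux (c q.1) q.2) :=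
    hux_cont.comp_continuous (f := fun q : ℝ × ℝ => (c q.1, q.2)) (by fun_prop)
      (fun q => ⟨hsub (hcm q.1), trivial⟩)
  have hP : Continuous (fun q : ℝ × ℝ => φ (c q.1) q.2) :=
    hc.comp_continuous (f := fun q : ℝ × ℝ => (c q.1, q.2)) (by fun_prop)
      (fun q => ⟨hcm q.1, trivial⟩)
  set a : ℝ × ℝ → ℝ → ℝ := fun p s => ∫ θ in (0 : ℝ)..1,
    ux (c s) (φ (c s) p.1 + θ * (φ (c s) p.2 - φ (c s) p.1)) with ha
  have hac : Continuous (Function.uncurry a) := by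
    have h1 : Continuous (fun q : (ℝ × ℝ) × ℝ => φ (c q.2) q.1.1) :=
      hP.comp (by fun_prop : Continuous (fun q : (ℝ × ℝ) × ℝ => (q.2, q.1.1)))
    have h2 : Continuous (fun q : (ℝ × ℝ) × ℝ => φ (c q.2) q.1.2) :=
      hP.comp (by fun_prop : Continuous (fun q : (ℝ × ℝ) × ℝ => (q.2, q.1.2)))
    apply intervalIntegral.continuous_parametric_intervalIntegral_of_continuous' (μ := MeasureTheory.volume)
      (f := fun (q : (ℝ × ℝ) × ℝ) θ =>
        ux (c q.2) (φ (c q.2) q.1.1 + θ * (φ (c q.2) q.1.2 - φ (c q.2) q.1.1)))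
    have h1' := h1.comp (continuous_fst (X := (ℝ × ℝ) × ℝ) (Y := ℝ))
    have h2' := h2.comp (continuous_fst (X := (ℝ × ℝ) × ℝ) (Y := ℝ))
    exact hW.comp (f := fun z : ((ℝ × ℝ) × ℝ) × ℝ =>
      (z.1.2, φ (c z.1.2) z.1.1.1 + z.2 * (φ (c z.1.2) z.1.1.2 - φ (c z.1.2) z.1.1.1)))
      ((by fun_prop : Continuous fun z : ((ℝ × ℝ) × ℝ) × ℝ => z.1.2).prodMk
        (h1'.add (continuous_snd.mul (h2'.sub h1'))))
  have hA : Continuous (fun p : ℝ × ℝ × ℝ => ∫ s in (0 : ℝ)..p.1, a p.2 s) := by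
    apply intervalIntegral.continuous_parametric_intervalIntegral_of_continuous (μ := MeasureTheory.volume)
      (f := fun (p : ℝ × ℝ × ℝ) s => a p.2 s)
    · exact hac.comp (by fun_prop : Continuous fun z : (ℝ × ℝ × ℝ) × ℝ => (z.1.2, z.2))
    · exact continuous_fst
  refine ⟨fun p => Real.exp (∫ s in (0 : ℝ)..p.1, a p.2 s), Real.continuous_exp.comp hA,
    fun p => Real.exp_pos _, fun t ht => ⟨fun x => ?_, fun x y => ?_⟩⟩
  · refine congrArg Real.exp ?_
    apply intervalIntegral.integral_congr
    intro s hs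
    rw [uIcc_of_le ht.1] at hs
    simp [ha, hce s ⟨hs.1, hs.2.trans ht.2⟩]
  · -- a * d = u - u
    have had : ∀ s ∈ Icc 0 b, (φ s y - φ s x) * a (x, y) s = u s (φ s y) - u s (φ s x) := by
      intro s hs
      have hl : ∀ θ : ℝ, HasDerivAt (fun θ => u s (φ s x + θ * (φ s y - φ s x)))
          (ux s (φ s x + θ * (φ s y - φ s x)) * (φ s y - φ s x)) θ := by
        intro θ
        have : HasDerivAt (fun θ : ℝ => φ s x + θ * (φ s y - φ s x)) (φ s y - φ s x) θ := by
          simpa using ((hasDerivAt_id θ).mul_const (φ s y - φ s x)).const_add (φ s x)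
        exact (hux s (hsub hs) _).comp θ this
      have hcont : Continuous (fun θ : ℝ => ux s (φ s x + θ * (φ s y - φ s x))) := by
        have := hW.comp (f := fun θ : ℝ => (s, φ s x + θ * (φ s y - φ s x))) (by fun_prop)
        simpa [Function.comp_def, hce s hs] using this
      have := intervalIntegral.integral_eq_sub_of_hasDerivAt (a := (0 : ℝ)) (b := 1)
        (fun θ _ => hl θ) ((hcont.mul continuous_const).intervalIntegrable _ _)
      rw [intervalIntegral.integral_mul_const] at this
      simp only [ha, hce s hs]
      rw [mul_comm, this]
      simp
    have hder : ∀ s ∈ Icc 0 b, HasDerivWithinAt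
        (fun s => (φ s y - φ s x) * Real.exp (-∫ r in (0 : ℝ)..s, a (x, y) r)) 0 (Icc 0 b) s := by
      intro s hs
      have h1 := ((hφ s (hsub hs) y).mono hsub).sub ((hφ s (hsub hs) x).mono hsub)
      have hcs : Continuous (a (x, y)) :=
        hac.comp (by fun_prop : Continuous fun s : ℝ => ((x, y), s))
      have h2 := (intervalIntegral.integral_hasDerivAt_right (hcs.intervalIntegrable 0 s)
        (hcs.stronglyMeasurableAtFilter _ _) hcs.continuousAt).neg.exp.hasDerivWithinAt (s := Icc 0 b)
      refine (h1.mul h2).congr_deriv ?_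
      have := had s hs
      simp only [Pi.sub_apply, Pi.neg_apply]
      rw [← this]
      ring
    have hconst := (convex_Icc 0 b).norm_image_sub_le_of_norm_hasDerivWithin_le (C := 0) hder
      (fun s _ => by simp) (left_mem_Icc.2 hb.1) ht
    rw [zero_mul, norm_le_zero_iff, sub_eq_zero] at hconst
    simp only [intervalIntegral.integral_same, neg_zero, Real.exp_zero, mul_one, h0] at hconst
    rw [← hconst, mul_assoc, ← Real.exp_add]
    simp

/-- Existence, uniqueness and regularity of the flow of a time-dependent
velocity field `u : [0,T) × ℝ → ℝ` which is continuous, `C¹` in `x` (with spatial derivative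
`ux`), and bounded together with `ux` on `[0,t'] × ℝ` for every `t' < T`.  There is a unique
`C¹` function `φ` on `[0,T) × ℝ` with `∂_t φ(t,x) = u(t,φ(t,x))`, `φ(0,x) = x`; moreover
`∂_x φ(t,x) = exp(∫₀^t ∂_x u(s,φ(s,x)) ds) > 0` and each `φ(t,·)` is a strictly increasing
bijection of `ℝ`. -/
theorem stmt0 (T : ℝ) (hT : 0 < T)
    (u ux : ℝ → ℝ → ℝ)
    (hu_cont : ContinuousOn (fun q : ℝ × ℝ => u q.1 q.2)
      (Set.Ico 0 T ×ˢ (Set.univ : Set ℝ)))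
    (hux_cont : ContinuousOn (fun q : ℝ × ℝ => ux q.1 q.2)
      (Set.Ico 0 T ×ˢ (Set.univ : Set ℝ)))
    (hux : ∀ t ∈ Set.Ico (0 : ℝ) T, ∀ x : ℝ, HasDerivAt (u t) (ux t x) x)
    (hbdd : ∀ t' ∈ Set.Ico (0 : ℝ) T, ∃ M : ℝ,
      ∀ t ∈ Set.Icc (0 : ℝ) t', ∀ x : ℝ, |u t x| ≤ M ∧ |ux t x| ≤ M) :
    ∃ φ : ℝ → ℝ → ℝ,
      -- φ is C¹ on [0,T) × ℝ and solves the ODE with initial condition φ(0,x) = x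
      (ContDiffOn ℝ 1 (fun q : ℝ × ℝ => φ q.1 q.2) (Set.Ico 0 T ×ˢ (Set.univ : Set ℝ)) ∧
        (∀ x : ℝ, φ 0 x = x) ∧
        (∀ t ∈ Set.Ico (0 : ℝ) T, ∀ x : ℝ,
          HasDerivWithinAt (fun s => φ s x) (u t (φ t x)) (Set.Ico 0 T) t)) ∧
      -- the spatial derivative formula, and its (strict) positivity
      (∀ t ∈ Set.Ico (0 : ℝ) T, ∀ x : ℝ,
        HasDerivAt (φ t) (Real.exp (∫ s in (0 : ℝ)..t, ux s (φ s x))) x ∧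
          0 < Real.exp (∫ s in (0 : ℝ)..t, ux s (φ s x))) ∧
      -- each φ(t,·) is a strictly increasing bijection of ℝ
      (∀ t ∈ Set.Ico (0 : ℝ) T, StrictMono (φ t) ∧ Function.Bijective (φ t)) ∧
      -- uniqueness
      (∀ ψ : ℝ → ℝ → ℝ,
        (ContDiffOn ℝ 1 (fun q : ℝ × ℝ => ψ q.1 q.2) (Set.Ico 0 T ×ˢ (Set.univ : Set ℝ)) ∧
          (∀ x : ℝ, ψ 0 x = x) ∧
          (∀ t ∈ Set.Ico (0 : ℝ) T, ∀ x : ℝ,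
            HasDerivWithinAt (fun s => ψ s x) (u t (ψ t x)) (Set.Ico 0 T) t)) →
        ∀ t ∈ Set.Ico (0 : ℝ) T, ∀ x : ℝ, ψ t x = φ t x) := by
  have hbdd' : ∀ t' ∈ Set.Ico (0 : ℝ) T, ∃ M : NNReal,
      ∀ t ∈ Set.Icc (0 : ℝ) t', ∀ x : ℝ, |u t x| ≤ M ∧ |ux t x| ≤ M := by
    intro t' ht'
    obtain ⟨M, hM⟩ := hbdd t' ht'
    refine ⟨M.toNNReal, fun t ht x => ?_⟩
    exact ⟨(hM t ht x).1.trans (Real.le_coe_toNNReal M), (hM t ht x).2.trans (Real.le_coe_toNNReal M)⟩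
  obtain ⟨φ, h0, hφ⟩ := aux_glue hu_cont hux hbdd' hT
  have hmid : ∀ t ∈ Ico 0 T, (t + T) / 2 ∈ Ico 0 T := fun t ht =>
    ⟨by linarith [ht.1, ht.2], by linarith [ht.2]⟩
  have hE : ∀ b ∈ Ico 0 T, ∃ E : ℝ × ℝ × ℝ → ℝ, Continuous E ∧ (∀ p, 0 < E p) ∧ ∀ t ∈ Icc 0 b,
      (∀ x, E (t, x, x) = Real.exp (∫ s in (0 : ℝ)..t, ux s (φ s x))) ∧
      ∀ x y, φ t y - φ t x = (y - x) * E (t, x, y) := by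
    intro b hb
    obtain ⟨M, hM⟩ := hbdd' b hb
    exact aux_core hux_cont hux hb h0 hφ (aux_cont hux hb hM h0 hφ)
  have hderiv : ∀ t ∈ Set.Ico (0 : ℝ) T, ∀ x : ℝ,
        HasDerivAt (φ t) (Real.exp (∫ s in (0 : ℝ)..t, ux s (φ s x))) x := by
    intro t ht x
    obtain ⟨E, hEc, hEp, hE⟩ := hE t ht
    obtain ⟨hE1, hE2⟩ := hE t ⟨ht.1, le_rfl⟩
    rw [hasDerivAt_iff_tendsto_slope, ← hE1 x]
    have h1 : Continuous (fun y => E (t, x, y)) := hEc.comp (by fun_prop)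
    refine ((h1.tendsto x).mono_left nhdsWithin_le_nhds).congr' ?_
    filter_upwards [self_mem_nhdsWithin] with y hy
    have hyx : y - x ≠ 0 := sub_ne_zero.2 hy
    rw [slope_def_field, hE2 x y]
    field_simp
  have hnhds : ∀ t ∈ Ico 0 T, ∀ x : ℝ, (Icc 0 ((t + T) / 2)) ×ˢ (univ : Set ℝ) ∈
      𝓝[Ico 0 T ×ˢ (univ : Set ℝ)] (t, x) := by
    intro t ht x
    have h : (Iio ((t + T) / 2)) ×ˢ (univ : Set ℝ) ∈ 𝓝 (t, x) :=
      prod_mem_nhds (Iio_mem_nhds (by linarith [ht.2])) univ_mem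
    filter_upwards [self_mem_nhdsWithin, mem_nhdsWithin_of_mem_nhds h] with q h1 h2
    exact ⟨⟨h1.1.1, le_of_lt h2.1⟩, trivial⟩
  have hcont : ContinuousOn (fun q : ℝ × ℝ => φ q.1 q.2) (Ico 0 T ×ˢ univ) := by
    rintro ⟨t, x⟩ ⟨ht, -⟩
    obtain ⟨M, hM⟩ := hbdd' _ (hmid t ht)
    exact (aux_cont hux (hmid t ht) hM h0 hφ (t, x)
      ⟨⟨ht.1, by linarith [ht.2]⟩, trivial⟩).mono_of_mem_nhdsWithin (hnhds t ht x)
  have hcontE : ContinuousOn (fun q : ℝ × ℝ => Real.exp (∫ s in (0 : ℝ)..q.1, ux s (φ s q.2)))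
      (Ico 0 T ×ˢ univ) := by
    rintro ⟨t, x⟩ ⟨ht, -⟩
    obtain ⟨E, hEc, hEp, hE⟩ := hE _ (hmid t ht)
    have h1 : Continuous (fun q : ℝ × ℝ => E (q.1, q.2, q.2)) := hEc.comp (by fun_prop)
    refine h1.continuousWithinAt.congr_of_eventuallyEq ?_ ?_
    · filter_upwards [hnhds t ht x] with q hq
      exact ((hE q.1 hq.1).1 q.2).symm
    · exact ((hE t ⟨ht.1, by linarith [ht.2]⟩).1 x).symm
  have hcontU : ContinuousOn (fun q : ℝ × ℝ => u q.1 (φ q.1 q.2)) (Ico 0 T ×ˢ univ) :=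
    hu_cont.comp (f := fun q : ℝ × ℝ => (q.1, φ q.1 q.2)) (continuousOn_fst.prodMk hcont)
      (fun q hq => ⟨hq.1, trivial⟩)
  have hfd : ∀ q ∈ Ico 0 T ×ˢ (univ : Set ℝ), HasFDerivWithinAt (fun q : ℝ × ℝ => φ q.1 q.2)
      (u q.1 (φ q.1 q.2) • ContinuousLinearMap.fst ℝ ℝ ℝ +
        Real.exp (∫ s in (0 : ℝ)..q.1, ux s (φ s q.2)) • ContinuousLinearMap.snd ℝ ℝ ℝ)
      (Ico 0 T ×ˢ univ) q := by
    rintro ⟨t, x⟩ ⟨ht, -⟩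
    obtain ⟨E, hEc, hEp, hE⟩ := hE _ (hmid t ht)
    have htm : t ∈ Icc 0 ((t + T) / 2) := ⟨ht.1, by linarith [ht.2]⟩
    simp only
    rw [← (hE t htm).1 x]
    -- time part
    have h1 : HasFDerivWithinAt (fun q : ℝ × ℝ => φ q.1 x)
        (u t (φ t x) • ContinuousLinearMap.fst ℝ ℝ ℝ) (Ico 0 T ×ˢ univ) (t, x) := by
      have hf : HasFDerivWithinAt (fun q : ℝ × ℝ => q.1) (ContinuousLinearMap.fst ℝ ℝ ℝ)
        (Ico 0 T ×ˢ univ) (t, x) := hasFDerivWithinAt_fst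
      have := (hφ t ht x).comp_hasFDerivWithinAt (f := fun q : ℝ × ℝ => q.1) (t, x)
        hf (fun q hq => hq.1)
      exact this
    have h2 : HasFDerivWithinAt (fun q : ℝ × ℝ => (q.2 - x) * E (q.1, x, q.2))
        (E (t, x, x) • ContinuousLinearMap.snd ℝ ℝ ℝ) (Ico 0 T ×ˢ univ) (t, x) := by
      apply HasFDerivAt.hasFDerivWithinAt
      rw [hasFDerivAt_iff_isLittleO]
      have hg : Continuous (fun q : ℝ × ℝ => E (q.1, x, q.2) - E (t, x, x)) :=
        (hEc.comp (by fun_prop : Continuous fun q : ℝ × ℝ => (q.1, x, q.2))).sub continuous_const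
      have ho : (fun q : ℝ × ℝ => E (q.1, x, q.2) - E (t, x, x)) =o[𝓝 (t, x)]
          (fun _ => (1 : ℝ)) := by
        rw [Asymptotics.isLittleO_one_iff]
        simpa using hg.tendsto (t, x)
      have hO : (fun q : ℝ × ℝ => q.2 - x) =O[𝓝 (t, x)] (fun q => ‖q - (t, x)‖) := by
        apply Asymptotics.IsBigO.of_bound 1
        refine Eventually.of_forall fun q => ?_
        simpa using norm_snd_le (q - (t, x))
      refine ((hO.mul_isLittleO ho).congr ?_ ?_).of_norm_right
      · intro q
        simp
        ring
      · intro q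
        simp
    have h3 := h1.add h2
    refine h3.congr_of_eventuallyEq ?_ ?_
    · filter_upwards [hnhds t ht x] with q hq
      have := (hE q.1 hq.1).2 x q.2
      simp only [Pi.add_apply]
      linarith
    · simp
  have hcd : ContDiffOn ℝ 1 (fun q : ℝ × ℝ => φ q.1 q.2) (Set.Ico 0 T ×ˢ (Set.univ : Set ℝ)) := by
    have hud : UniqueDiffOn ℝ (Set.Ico 0 T ×ˢ (Set.univ : Set ℝ)) :=
      (uniqueDiffOn_Ico 0 T).prod uniqueDiffOn_univ
    rw [show (1 : WithTop ℕ∞) = 0 + 1 by simp,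
      contDiffOn_succ_iff_hasFDerivWithinAt_of_uniqueDiffOn hud]
    refine ⟨by simp, _, ?_, hfd⟩
    rw [contDiffOn_zero]
    exact (hcontU.smul continuousOn_const).add (hcontE.smul continuousOn_const)
  have hmono : ∀ t ∈ Ico 0 T, StrictMono (φ t) := by
    intro t ht x y hxy
    obtain ⟨E, hEc, hEp, hE⟩ := hE t ht
    have h1 := (hE t ⟨ht.1, le_rfl⟩).2 x y
    have h2 := mul_pos (sub_pos.2 hxy) (hEp (t, x, y))
    linarith
  have hclose : ∀ t ∈ Ico 0 T, ∃ C : ℝ, ∀ x, |φ t x - x| ≤ C := by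
    intro t ht
    obtain ⟨M, hM⟩ := hbdd' t ht
    have hsub : Icc 0 t ⊆ Ico 0 T := fun s hs => ⟨hs.1, hs.2.trans_lt ht.2⟩
    refine ⟨M * ‖t - 0‖, fun x => ?_⟩
    have := (convex_Icc 0 t).norm_image_sub_le_of_norm_hasDerivWithin_le (C := M)
      (f := fun s => φ s x) (f' := fun s => u s (φ s x))
      (fun s hs => (hφ s (hsub hs) x).mono hsub)
      (fun s hs => (hM s hs _).1) (left_mem_Icc.2 ht.1) (right_mem_Icc.2 ht.1)
    simpa only [h0, Real.norm_eq_abs] using this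
  refine ⟨φ, ⟨hcd, h0, hφ⟩, fun t ht x => ⟨hderiv t ht x, Real.exp_pos _⟩,
    fun t ht => ⟨hmono t ht, (hmono t ht).injective, ?_⟩, ?_⟩
  · obtain ⟨C, hC⟩ := hclose t ht
    have hct : Continuous (φ t) :=
      continuous_iff_continuousAt.2 fun x => (hderiv t ht x).continuousAt
    apply hct.surjective
    · exact tendsto_atTop_mono (fun x => by simp only [id]; linarith [(abs_le.1 (hC x)).1])
        (tendsto_atTop_add_const_right atTop (-C) tendsto_id)
    · exact tendsto_atBot_mono (fun x => by simp only [id]; linarith [(abs_le.1 (hC x)).2])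
        (tendsto_atBot_add_const_right atBot C tendsto_id)
  · rintro ψ ⟨-, hψ0, hψ⟩ t ht x
    obtain ⟨M, hM⟩ := hbdd' t ht
    have hsub : Icc 0 t ⊆ Ico 0 T := fun s hs => ⟨hs.1, hs.2.trans_lt ht.2⟩
    have := aux_dist hux ht hM (f := fun s => ψ s x) (g := fun s => φ s x)
      (fun s hs => (hψ s (hsub hs) x).mono hsub) (fun s hs => (hφ s (hsub hs) x).mono hsub)
      t (right_mem_Icc.2 ht.1)
    simp only [h0, hψ0, dist_self, zero_mul] at this
    exact dist_le_zero.1 this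
end

section
/- Let 0 < T < ∞, b ∈ ℝ, let u : [0,T) × ℝ → ℝ be continuous, continuously differentiable in x, with u and ∂_x u bounded on [0,t'] × ℝ for every t' < T, let φ be its flow with ∂_x φ(t,x) = exp(∫₀^t ∂_x u(s, φ(s,x)) ds) > 0, and let ρ : [0,T) × ℝ → ℝ be a continuously differentiable bounded solution of ∂_t ρ + u ∂_x ρ + (b−1)(∂_x u) ρ = 0 with ρ(0,·) = ρ₀ bounded. If there exists M₁ > 0 such that (b−1) ∂_x u(t, φ(t,x)) ≥ −M₁ for all (t,x) ∈ [0,T) × ℝ, then for all t ∈ [0,T): ‖ρ(t,·)‖_{L^∞(ℝ)} = ‖ρ(t, φ(t,·))‖_{L^∞(ℝ)} ≤ e^{M₁ T} ‖ρ₀‖_{L^∞(ℝ)}. -/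
open MeasureTheory

open Asymptotics Filter in
open scoped Convex Topology in
theorem aux_isLittleO_sub_sub_fderiv
    {α 𝕜 E F : Type*} [NontriviallyNormedField 𝕜] [IsRCLikeNormedField 𝕜] [NormedAddCommGroup E]
    [NormedSpace ℝ E] [NormedSpace 𝕜 E] [NormedAddCommGroup F] [NormedSpace 𝕜 F]
    {u : E} {v w : α → E} {l : Filter α} (hv : Tendsto v l (𝓝 u)) (hw : Tendsto w l (𝓝 u))
    (s : Set E := Set.univ) (seg : ∀ᶠ χ in l, [w χ -[ℝ] v χ] ⊆ s := by simp)
    {f : α → E → F} {f' : α → E → E →L[𝕜] F}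
    (df' : ∀ᶠ p in l ×ˢ 𝓝[s] u, HasFDerivWithinAt (f p.1) (f' p.1 p.2) s p.2)
    {φ : E →L[𝕜] F} (cf' : Tendsto ↿f' (l ×ˢ 𝓝[s] u) (𝓝 φ)) :
    (fun χ => f χ (v χ) - f χ (w χ) - φ (v χ - w χ)) =o[l] (fun χ => v χ - w χ) := by
  rw [isLittleO_iff]
  intro ε hε
  replace df' : ∀ᶠ χ in l, ∀ z ∈ [w χ -[ℝ] v χ], HasFDerivWithinAt (f χ) (f' χ z) s z :=
    df'.segment_of_prod_nhdsWithin hw hv seg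
  replace cf' : ∀ᶠ χ in l, ∀ z ∈ [w χ -[ℝ] v χ], ‖f' χ z - φ‖ < ε := by
    simp_rw [Metric.tendsto_nhds, dist_eq_norm_sub] at cf'
    exact (cf' ε hε).segment_of_prod_nhdsWithin hw hv seg
  filter_upwards [seg, df', cf'] with χ seg df' cf'
  exact Convex.norm_image_sub_le_of_norm_hasFDerivWithin_le'
    (fun z hz => (df' z hz).mono seg) (fun z hz => (cf' z hz).le)
    (convex_segment ..) (left_mem_segment ..) (right_mem_segment ..)

open Filter Topology in
theorem aux_eLp (f : ℝ → ℝ) (hf : Continuous f) : eLpNorm f ⊤ volume = ⨆ x, ‖f x‖ₑ := by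
  rw [eLpNorm_exponent_top, eLpNormEssSup_eq_essSup_enorm]
  symm
  apply iSup_eq_essSup
  intro x a hx
  have ho : IsOpen {y | a < ‖f y‖ₑ} := isOpen_lt continuous_const hf.enorm
  exact ho.measure_ne_zero volume ⟨x, hx⟩

open Filter Topology in
theorem aux_chain (T : ℝ) (ρ ρt ρx : ℝ → ℝ → ℝ) (γ : ℝ → ℝ) (γ' t : ℝ)
    (ht : t ∈ Set.Ico (0 : ℝ) T)
    (hγ : HasDerivWithinAt γ γ' (Set.Ico 0 T) t)
    (hρt : HasDerivWithinAt (fun s => ρ s (γ t)) (ρt t (γ t)) (Set.Ico 0 T) t)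
    (hρx : ∀ t ∈ Set.Ico (0 : ℝ) T, ∀ x : ℝ, HasDerivAt (ρ t) (ρx t x) x)
    (hρx_cont : ContinuousOn (fun q : ℝ × ℝ => ρx q.1 q.2)
      (Set.Ico 0 T ×ˢ (Set.univ : Set ℝ))) :
    HasDerivWithinAt (fun s => ρ s (γ s)) (ρt t (γ t) + ρx t (γ t) * γ') (Set.Ico 0 T) t := by
  have hA : (fun s => ρ s (γ s) - ρ s (γ t)
      - (ContinuousLinearMap.toSpanSingleton ℝ (ρx t (γ t))) (γ s - γ t))
      =o[𝓝[Set.Ico 0 T] t] (fun s => γ s - γ t) := by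
    refine aux_isLittleO_sub_sub_fderiv (𝕜 := ℝ) (u := γ t) (v := γ) (w := fun _ => γ t) (f := ρ)
      (f' := fun s y => ContinuousLinearMap.toSpanSingleton ℝ (ρx s y))
      hγ.continuousWithinAt tendsto_const_nhds Set.univ (by simp) ?_ ?_
    · have : ∀ᶠ s in 𝓝[Set.Ico 0 T] t, s ∈ Set.Ico 0 T := self_mem_nhdsWithin
      filter_upwards [this.prod_inl (𝓝[Set.univ] (γ t))] with p hp
      exact (hρx p.1 hp p.2).hasFDerivAt.hasFDerivWithinAt
    · have h1 : Tendsto (fun q : ℝ × ℝ => ρx q.1 q.2)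
          (𝓝[Set.Ico 0 T] t ×ˢ 𝓝[Set.univ] (γ t)) (𝓝 (ρx t (γ t))) := by
        rw [← nhdsWithin_prod_eq]
        exact hρx_cont (t, γ t) ⟨ht, trivial⟩
      have h2 : Continuous (fun r : ℝ => ContinuousLinearMap.toSpanSingleton ℝ r) :=
        (ContinuousLinearMap.toSpanSingletonCLE (𝕜 := ℝ) (E := ℝ)).continuous
      exact (h2.tendsto _).comp h1
  have hO : (fun s => γ s - γ t) =O[𝓝[Set.Ico 0 T] t] (fun s => s - t) :=
    hγ.hasFDerivWithinAt.isBigO_sub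
  have hA' : HasDerivWithinAt (fun s => ρ s (γ s) - ρ s (γ t) - (γ s - γ t) * ρx t (γ t)) 0
      (Set.Ico 0 T) t := by
    rw [hasDerivWithinAt_iff_isLittleO]
    simpa using hA.trans_isBigO hO
  have := (hA'.add hρt).add ((hγ.sub_const (γ t)).mul_const (ρx t (γ t)))
  exact (this.congr_deriv (by ring)).congr (fun s _ => by simp only [Pi.add_apply]; ring) (by simp)



/-- If `ρ` is a bounded `C¹` solution of the transport equation
`∂_t ρ + u ∂_x ρ + (b-1)(∂_x u) ρ = 0` along the flow `φ` of `u`, with bounded data `ρ₀`,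
and `(b-1) ∂_x u(t,φ(t,x)) ≥ -M₁` on `[0,T) × ℝ`, then for all `t ∈ [0,T)`:
`‖ρ(t,·)‖_{L^∞} = ‖ρ(t,φ(t,·))‖_{L^∞} ≤ e^{M₁ T} ‖ρ₀‖_{L^∞}`. -/
theorem stmt2 (T b M₁ : ℝ) (hT : 0 < T) (hM₁ : 0 < M₁)
    (u ux : ℝ → ℝ → ℝ)
    (hu_cont : ContinuousOn (fun q : ℝ × ℝ => u q.1 q.2)
      (Set.Ico 0 T ×ˢ (Set.univ : Set ℝ)))
    (hux_cont : ContinuousOn (fun q : ℝ × ℝ => ux q.1 q.2)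
      (Set.Ico 0 T ×ˢ (Set.univ : Set ℝ)))
    (hux : ∀ t ∈ Set.Ico (0 : ℝ) T, ∀ x : ℝ, HasDerivAt (u t) (ux t x) x)
    (hbdd : ∀ t' ∈ Set.Ico (0 : ℝ) T, ∃ M : ℝ,
      ∀ t ∈ Set.Icc (0 : ℝ) t', ∀ x : ℝ, |u t x| ≤ M ∧ |ux t x| ≤ M)
    -- φ is the C¹ flow of u
    (φ : ℝ → ℝ → ℝ)
    (hφC1 : ContDiffOn ℝ 1 (fun q : ℝ × ℝ => φ q.1 q.2) (Set.Ico 0 T ×ˢ (Set.univ : Set ℝ)))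
    (hφ0 : ∀ x : ℝ, φ 0 x = x)
    (hφt : ∀ t ∈ Set.Ico (0 : ℝ) T, ∀ x : ℝ,
      HasDerivWithinAt (fun s => φ s x) (u t (φ t x)) (Set.Ico 0 T) t)
    (hφx : ∀ t ∈ Set.Ico (0 : ℝ) T, ∀ x : ℝ,
      HasDerivAt (φ t) (Real.exp (∫ s in (0 : ℝ)..t, ux s (φ s x))) x)
    -- ρ is a bounded C¹ solution of the transport equation with bounded data ρ₀
    (ρ ρt ρx : ℝ → ℝ → ℝ) (ρ₀ : ℝ → ℝ)
    (hρ0 : ∀ x : ℝ, ρ 0 x = ρ₀ x)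
    (hρbdd : ∃ K : ℝ, ∀ t ∈ Set.Ico (0 : ℝ) T, ∀ x : ℝ, |ρ t x| ≤ K)
    (hρ₀bdd : ∃ K : ℝ, ∀ x : ℝ, |ρ₀ x| ≤ K)
    (hρt : ∀ t ∈ Set.Ico (0 : ℝ) T, ∀ x : ℝ,
      HasDerivWithinAt (fun s => ρ s x) (ρt t x) (Set.Ico 0 T) t)
    (hρx : ∀ t ∈ Set.Ico (0 : ℝ) T, ∀ x : ℝ, HasDerivAt (ρ t) (ρx t x) x)
    (hρt_cont : ContinuousOn (fun q : ℝ × ℝ => ρt q.1 q.2)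
      (Set.Ico 0 T ×ˢ (Set.univ : Set ℝ)))
    (hρx_cont : ContinuousOn (fun q : ℝ × ℝ => ρx q.1 q.2)
      (Set.Ico 0 T ×ˢ (Set.univ : Set ℝ)))
    (heq : ∀ t ∈ Set.Ico (0 : ℝ) T, ∀ x : ℝ,
      ρt t x + u t x * ρx t x + (b - 1) * ux t x * ρ t x = 0)
    -- the lower bound (b-1) ∂_x u(t,φ(t,x)) ≥ -M₁
    (hlow : ∀ t ∈ Set.Ico (0 : ℝ) T, ∀ x : ℝ, -M₁ ≤ (b - 1) * ux t (φ t x)) :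
    ∀ t ∈ Set.Ico (0 : ℝ) T,
      eLpNorm (ρ t) ⊤ volume = eLpNorm (fun x => ρ t (φ t x)) ⊤ volume ∧
      eLpNorm (ρ t) ⊤ volume ≤
        ENNReal.ofReal (Real.exp (M₁ * T)) * eLpNorm ρ₀ ⊤ volume := by
  intro t ht
  have hsub : Set.Icc 0 t ⊆ Set.Ico 0 T := fun s hs => ⟨hs.1, hs.2.trans_lt ht.2⟩
  have hφc : Continuous (φ t) :=
    continuous_iff_continuousAt.2 fun x => (hφx t ht x).continuousAt
  have hρc : ∀ s ∈ Set.Ico (0 : ℝ) T, Continuous (ρ s) := fun s hs =>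
    continuous_iff_continuousAt.2 fun x => (hρx s hs x).continuousAt
  have hρ₀ : ρ 0 = ρ₀ := funext hρ0
  have hρ₀c : Continuous ρ₀ := hρ₀ ▸ hρc 0 ⟨le_rfl, hT⟩
  have hsurj : Function.Surjective (φ t) := by
    obtain ⟨M, hM⟩ := hbdd t ht
    have hd : ∀ x, |φ t x - x| ≤ M * t := by
      intro x
      have := (convex_Icc (0:ℝ) t).norm_image_sub_le_of_norm_hasDerivWithin_le
        (f := fun s => φ s x) (f' := fun s => u s (φ s x)) (C := M)
        (fun s hs => (hφt s (hsub hs) x).mono hsub)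
        (fun s hs => (hM s hs _).1) (Set.left_mem_Icc.2 ht.1) (Set.right_mem_Icc.2 ht.1)
      simpa [hφ0, abs_of_nonneg ht.1] using this
    intro y
    refine mem_range_of_exists_le_of_exists_ge hφc ⟨y - M * t, ?_⟩ ⟨y + M * t, ?_⟩
    · have := (abs_le.1 (hd (y - M * t))).2
      linarith
    · have := (abs_le.1 (hd (y + M * t))).1
      linarith
  have hpt : ∀ x, |ρ t (φ t x)| ≤ Real.exp (M₁ * T) * |ρ₀ x| := by
    intro x
    have hg : ∀ s ∈ Set.Ico (0 : ℝ) T, HasDerivWithinAt (fun s => ρ s (φ s x))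
        (-((b - 1) * ux s (φ s x)) * ρ s (φ s x)) (Set.Ico 0 T) s := by
      intro s hs
      have := aux_chain T ρ ρt ρx (fun s => φ s x) _ s hs (hφt s hs x) (hρt s hs _) hρx hρx_cont
      convert this using 1
      have := heq s hs (φ s x)
      linarith
    have hh : ∀ s ∈ Set.Ico (0 : ℝ) T,
        HasDerivWithinAt (fun s => (Real.exp (-(M₁ * s)) * ρ s (φ s x)) ^ 2)
        (-2 * (M₁ + (b - 1) * ux s (φ s x)) * (Real.exp (-(M₁ * s)) * ρ s (φ s x)) ^ 2)
        (Set.Ico 0 T) s := by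
      intro s hs
      have he : HasDerivWithinAt (fun s => Real.exp (-(M₁ * s)))
          (Real.exp (-(M₁ * s)) * (-(M₁ * 1))) (Set.Ico 0 T) s :=
        (((hasDerivAt_id s).const_mul M₁).neg.exp).hasDerivWithinAt
      refine ((he.mul (hg s hs)).pow 2).congr_deriv ?_
      simp only [Pi.mul_apply]
      push_cast
      ring
    have hanti : AntitoneOn (fun s => (Real.exp (-(M₁ * s)) * ρ s (φ s x)) ^ 2)
        (Set.Ico 0 T) := by
      refine antitoneOn_of_hasDerivWithinAt_nonpos (convex_Ico 0 T)
        (fun s hs => (hh s hs).continuousWithinAt)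
        (fun s hs => (hh s (interior_subset hs)).mono interior_subset) ?_
      intro s hs
      have h1 := hlow s (interior_subset hs) x
      have h2 := sq_nonneg (Real.exp (-(M₁ * s)) * ρ s (φ s x))
      nlinarith
    have h0 := hanti ⟨le_rfl, hT⟩ ht ht.1
    simp only [mul_zero, neg_zero, Real.exp_zero, one_mul, hφ0, hρ0] at h0
    have h1 := sq_le_sq.1 h0
    rw [abs_mul, abs_of_pos (Real.exp_pos _), Real.exp_neg,
      inv_mul_le_iff₀ (Real.exp_pos _)] at h1
    refine h1.trans (mul_le_mul_of_nonneg_right (Real.exp_le_exp.2 ?_) (abs_nonneg _))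
    exact mul_le_mul_of_nonneg_left ht.2.le hM₁.le
  have heq1 : eLpNorm (ρ t) ⊤ volume = eLpNorm (fun x => ρ t (φ t x)) ⊤ volume := by
    rw [aux_eLp _ (hρc t ht), aux_eLp (fun x => ρ t (φ t x)) ((hρc t ht).comp hφc)]
    exact (hsurj.iSup_comp (fun y => ‖ρ t y‖ₑ)).symm
  refine ⟨heq1, ?_⟩
  rw [heq1]
  exact eLpNorm_le_mul_eLpNorm_of_ae_le_mul (Filter.Eventually.of_forall hpt) _
end

section
/- Let T > 0, b ∈ ℝ with b ≠ 1, let u : [0,T) × ℝ → ℝ be continuous, continuously differentiable in x, with u and ∂_x u bounded on [0,t'] × ℝ for every t' < T, let φ be its flow with ∂_x φ(t,x) = exp(∫₀^t ∂_x u(s, φ(s,x)) ds) > 0, and let ρ : [0,T) × ℝ → ℝ be a continuously differentiable solution of ∂_t ρ + u ∂_x ρ + (b−1)(∂_x u) ρ = 0 with ρ(0,·) = ρ₀. If the integral ∫_ℝ |ρ₀(x)|^{1/(b−1)} dx is finite, then for every t ∈ [0,T): ∫_ℝ |ρ(t,x)|^{1/(b−1)} dx = ∫_ℝ |ρ₀(x)|^{1/(b−1)}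 dx. -/
open MeasureTheory

lemma chain_aux (S : Set ℝ) (f fx : ℝ → ℝ → ℝ) (γ : ℝ → ℝ) (t a v : ℝ) (ht : t ∈ S)
    (hfx : ∀ s ∈ S, ∀ y, HasDerivAt (f s) (fx s y) y)
    (hc : ContinuousOn (fun q : ℝ × ℝ => fx q.1 q.2) (S ×ˢ (Set.univ : Set ℝ)))
    (ha : HasDerivWithinAt (fun s => f s (γ t)) a S t)
    (hγ : HasDerivWithinAt γ v S t) :
    HasDerivWithinAt (fun s => f s (γ s)) (a + fx t (γ t) * v) S t := by
  have key : ∀ s, ∃ c, s ∈ S → (|c - γ t| ≤ |γ s - γ t| ∧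
      f s (γ s) - f s (γ t) = fx s c * (γ s - γ t)) := by
    intro s
    by_cases hs : s ∈ S
    swap
    · exact ⟨0, fun h => absurd h hs⟩
    have hcont : Continuous (f s) :=
      continuous_iff_continuousAt.2 fun y => (hfx s hs y).continuousAt
    rcases lt_trichotomy (γ s) (γ t) with h | h | h
    · obtain ⟨c, hc, hc'⟩ := exists_hasDerivAt_eq_slope (f s) (fx s) h hcont.continuousOn
        (fun y _ => hfx s hs y)
      refine ⟨c, fun _ => ⟨?_, ?_⟩⟩
      · rw [abs_of_neg (by linarith [hc.2]), abs_of_neg (by linarith)]; linarith [hc.1]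
      · rw [hc']
        have : γ t - γ s ≠ 0 := by linarith
        field_simp
        ring
    · exact ⟨γ t, fun _ => by simp [h]⟩
    · obtain ⟨c, hc, hc'⟩ := exists_hasDerivAt_eq_slope (f s) (fx s) h hcont.continuousOn
        (fun y _ => hfx s hs y)
      refine ⟨c, fun _ => ⟨?_, ?_⟩⟩
      · rw [abs_of_pos (by linarith [hc.1]), abs_of_pos (by linarith)]; linarith [hc.2]
      · rw [hc']
        have : γ s - γ t ≠ 0 := by linarith
        field_simp
  choose c hcS using key
  have hγc := hγ.continuousWithinAt
  have hclim : Filter.Tendsto c (nhdsWithin t S) (nhds (γ t)) := by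
    rw [tendsto_iff_norm_sub_tendsto_zero]
    have h1 := tendsto_iff_norm_sub_tendsto_zero.1 hγc
    refine squeeze_zero' (Filter.Eventually.of_forall fun _ => norm_nonneg _) ?_ h1
    filter_upwards [self_mem_nhdsWithin] with s hs
    exact (hcS s hs).1
  have hk : Filter.Tendsto (fun s => fx s (c s)) (nhdsWithin t S) (nhds (fx t (γ t))) := by
    have h1 := hc (t, γ t) ⟨ht, trivial⟩
    have h2 : Filter.Tendsto (fun s => (s, c s)) (nhdsWithin t S)
        (nhdsWithin (t, γ t) (S ×ˢ (Set.univ : Set ℝ))) := by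
      refine tendsto_nhdsWithin_iff.2 ⟨?_, ?_⟩
      · exact (Filter.tendsto_id.mono_left nhdsWithin_le_nhds).prodMk_nhds hclim
      · filter_upwards [self_mem_nhdsWithin] with s hs
        exact ⟨hs, trivial⟩
    exact h1.tendsto.comp h2
  have hd : HasDerivWithinAt (fun s => f s (γ s) - f s (γ t)) (fx t (γ t) * v) S t := by
    rw [hasDerivWithinAt_iff_tendsto_slope] at hγ ⊢
    refine ((hk.mono_left (nhdsWithin_mono _ Set.sdiff_subset)).mul hγ).congr' ?_
    filter_upwards [self_mem_nhdsWithin] with s hs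
    simp only [slope_def_field, (hcS s hs.1).2]
    ring
  have := ha.add hd
  refine this.congr_of_mem (fun s _ => ?_) ht
  simp

/-- If `b ≠ 1`, `ρ` is a `C¹` solution of the transport equation
`∂_t ρ + u ∂_x ρ + (b-1)(∂_x u) ρ = 0` along the flow `φ` of `u`, with data `ρ₀`, and
`∫_ℝ |ρ₀|^{1/(b-1)}` is finite, then `∫_ℝ |ρ(t,x)|^{1/(b-1)} dx = ∫_ℝ |ρ₀(x)|^{1/(b-1)} dx`
for every `t ∈ [0,T)`. -/
theorem stmt3 (T b : ℝ) (hT : 0 < T) (hb : b ≠ 1)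
    (u ux : ℝ → ℝ → ℝ)
    (hu_cont : ContinuousOn (fun q : ℝ × ℝ => u q.1 q.2)
      (Set.Ico 0 T ×ˢ (Set.univ : Set ℝ)))
    (hux_cont : ContinuousOn (fun q : ℝ × ℝ => ux q.1 q.2)
      (Set.Ico 0 T ×ˢ (Set.univ : Set ℝ)))
    (hux : ∀ t ∈ Set.Ico (0 : ℝ) T, ∀ x : ℝ, HasDerivAt (u t) (ux t x) x)
    (hbdd : ∀ t' ∈ Set.Ico (0 : ℝ) T, ∃ M : ℝ,
      ∀ t ∈ Set.Icc (0 : ℝ) t', ∀ x : ℝ, |u t x| ≤ M ∧ |ux t x| ≤ M)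
    -- φ is the C¹ flow of u
    (φ : ℝ → ℝ → ℝ)
    (hφC1 : ContDiffOn ℝ 1 (fun q : ℝ × ℝ => φ q.1 q.2) (Set.Ico 0 T ×ˢ (Set.univ : Set ℝ)))
    (hφ0 : ∀ x : ℝ, φ 0 x = x)
    (hφt : ∀ t ∈ Set.Ico (0 : ℝ) T, ∀ x : ℝ,
      HasDerivWithinAt (fun s => φ s x) (u t (φ t x)) (Set.Ico 0 T) t)
    (hφx : ∀ t ∈ Set.Ico (0 : ℝ) T, ∀ x : ℝ,
      HasDerivAt (φ t) (Real.exp (∫ s in (0 : ℝ)..t, ux s (φ s x))) x)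
    -- ρ is a C¹ solution of the transport equation with data ρ₀
    (ρ ρt ρx : ℝ → ℝ → ℝ) (ρ₀ : ℝ → ℝ)
    (hρ0 : ∀ x : ℝ, ρ 0 x = ρ₀ x)
    (hρt : ∀ t ∈ Set.Ico (0 : ℝ) T, ∀ x : ℝ,
      HasDerivWithinAt (fun s => ρ s x) (ρt t x) (Set.Ico 0 T) t)
    (hρx : ∀ t ∈ Set.Ico (0 : ℝ) T, ∀ x : ℝ, HasDerivAt (ρ t) (ρx t x) x)
    (hρt_cont : ContinuousOn (fun q : ℝ × ℝ => ρt q.1 q.2)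
      (Set.Ico 0 T ×ˢ (Set.univ : Set ℝ)))
    (hρx_cont : ContinuousOn (fun q : ℝ × ℝ => ρx q.1 q.2)
      (Set.Ico 0 T ×ˢ (Set.univ : Set ℝ)))
    (heq : ∀ t ∈ Set.Ico (0 : ℝ) T, ∀ x : ℝ,
      ρt t x + u t x * ρx t x + (b - 1) * ux t x * ρ t x = 0)
    -- ∫ |ρ₀|^{1/(b-1)} is finite
    (hint : Integrable (fun x => |ρ₀ x| ^ ((1 : ℝ) / (b - 1))) volume) :
    ∀ t ∈ Set.Ico (0 : ℝ) T,
      ∫ x : ℝ, |ρ t x| ^ ((1 : ℝ) / (b - 1)) = ∫ x : ℝ, |ρ₀ x| ^ ((1 : ℝ) / (b - 1)) := by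
  intro t ht
  have hsub : Set.Icc (0 : ℝ) t ⊆ Set.Ico 0 T := fun s hs => ⟨hs.1, hs.2.trans_lt ht.2⟩
  have hb' : b - 1 ≠ 0 := sub_ne_zero.2 hb
  have hp : (1 : ℝ) / (b - 1) ≠ 0 := one_div_ne_zero hb'
  -- conservation along characteristics
  have hcons : ∀ x, ρ t (φ t x) * Real.exp ((b - 1) * ∫ s in (0 : ℝ)..t, ux s (φ s x)) = ρ₀ x := by
    intro x
    have hcu : ContinuousOn (fun s => ux s (φ s x)) (Set.Icc 0 t) := by
      have h2 : ContinuousOn (fun s => (s, φ s x)) (Set.Icc 0 t) :=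
        continuousOn_id.prodMk fun s hs =>
          ((hφt s (hsub hs) x).continuousWithinAt).mono hsub
      exact hux_cont.comp h2 fun s hs => ⟨hsub hs, trivial⟩
    have hI : ∀ s ∈ Set.Icc 0 t, HasDerivWithinAt (fun r => ∫ s in (0 : ℝ)..r, ux s (φ s x))
        (ux s (φ s x)) (Set.Icc 0 t) s := by
      intro s hs
      have := Fact.mk hs
      apply intervalIntegral.integral_hasDerivWithinAt_right
      · exact (hcu.mono (Set.Icc_subset_Icc le_rfl hs.2)).intervalIntegrable_of_Icc hs.1
      · exact hcu.stronglyMeasurableAtFilter_nhdsWithin measurableSet_Icc s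
      · exact hcu.continuousWithinAt hs
    have hG : ∀ s ∈ Set.Icc 0 t, HasDerivWithinAt
        (fun s => ρ s (φ s x) * Real.exp ((b - 1) * ∫ r in (0 : ℝ)..s, ux r (φ r x)))
        0 (Set.Icc 0 t) s := by
      intro s hs
      have h1 := (chain_aux (Set.Ico 0 T) ρ ρx (fun s => φ s x) s _ _ (hsub hs) hρx hρx_cont
        (hρt s (hsub hs) (φ s x)) (hφt s (hsub hs) x)).mono hsub
      have h2 := h1.mul ((hI s hs).const_mul (b - 1)).exp
      refine h2.congr_deriv ?_
      have := heq s (hsub hs) (φ s x)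
      linear_combination (Real.exp ((b - 1) * ∫ r in (0 : ℝ)..s, ux r (φ r x))) * this
    have h0 : (0 : ℝ) ∈ Set.Icc 0 t := ⟨le_rfl, ht.1⟩
    have h1 : t ∈ Set.Icc 0 t := ⟨ht.1, le_rfl⟩
    have := (convex_Icc (0 : ℝ) t).norm_image_sub_le_of_norm_hasDerivWithin_le (C := 0) hG
      (fun _ _ => by simp) h0 h1
    rw [zero_mul, norm_le_zero_iff, sub_eq_zero] at this
    simpa [hφ0, hρ0] using this
  -- the flow map is a bijection
  have hinj : Function.Injective (φ t) :=
    (strictMono_of_hasDerivAt_pos (hφx t ht) fun x => Real.exp_pos _).injective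
  obtain ⟨M, hM⟩ := hbdd t ht
  have hdist : ∀ x, |φ t x - x| ≤ M * t := by
    intro x
    have := (convex_Icc (0 : ℝ) t).norm_image_sub_le_of_norm_hasDerivWithin_le (C := M)
      (fun s hs => (hφt s (hsub hs) x).mono hsub)
      (fun s hs => (hM s hs _).1) ⟨le_rfl, ht.1⟩ ⟨ht.1, le_rfl⟩
    simpa [hφ0, abs_of_nonneg ht.1] using this
  have hsurj : Function.Surjective (φ t) := by
    refine Continuous.surjective
      (continuous_iff_continuousAt.2 fun y => (hφx t ht y).continuousAt) ?_ ?_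
    · refine Filter.tendsto_atTop_mono (f := fun x => x + -(M * t)) (fun x => ?_)
        (Filter.tendsto_atTop_add_const_right _ _ Filter.tendsto_id)
      linarith [(abs_le.1 (hdist x)).1]
    · refine Filter.tendsto_atBot_mono (f := fun x => x + M * t) (fun x => ?_)
        (Filter.tendsto_atBot_add_const_right _ _ Filter.tendsto_id)
      linarith [(abs_le.1 (hdist x)).2]
  have hcv := integral_image_eq_integral_abs_deriv_smul (s := Set.univ) MeasurableSet.univ
    (fun x _ => (hφx t ht x).hasDerivWithinAt) hinj.injOn
    (fun y => |ρ t y| ^ ((1 : ℝ) / (b - 1)))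
  rw [Set.image_univ, hsurj.range_eq, setIntegral_univ, setIntegral_univ] at hcv
  rw [hcv]
  refine integral_congr_ae (Filter.Eventually.of_forall fun x => ?_)
  simp only [smul_eq_mul]
  rw [← hcons x, abs_mul, Real.abs_exp, Real.abs_exp,
    Real.mul_rpow (abs_nonneg _) (Real.exp_pos _).le, ← Real.exp_mul, mul_comm]
  congr 2
  field_simp
end

section
/- Let T > 0 and C_T > 0, and let (V_k)_{k ∈ ℕ} be a sequence of nonnegative continuous functions on [0,T] such that sup_{t ∈ [0,T]} V₀(t) ≤ C_T and, for all k ∈ ℕ and all t ∈ [0,T], V_{k+1}(t) ≤ C_T ( 2^{-k} + ∫₀^t V_k(τ) dτ ). Then for all k ∈ ℕ and t ∈ [0,T]: V_{k+1}(t) ≤ 2^{-k} · C_T · Σ_{i=0}^{k} (2 T C_T)^i / i! + C_T · (T C_T)^{k+1} / (k+1)!. In particular, sup_{t ∈ [0,T]} V_k(t) → 0 as k → ∞. -/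
/-- The comparison functions. -/
noncomputable def bnd16 (C : ℝ) (k : ℕ) (t : ℝ) : ℝ :=
  C * 2 / 2 ^ k * (∑ i ∈ Finset.range k, (2 * t * C) ^ i / (Nat.factorial i : ℝ)) +
    C * (t * C) ^ k / (Nat.factorial k : ℝ)

theorem bnd16_term (c : ℝ) (i : ℕ) (t : ℝ) :
    HasDerivAt (fun t : ℝ => (t * c) ^ (i + 1) / (Nat.factorial (i + 1) : ℝ))
      (c * ((t * c) ^ i / (Nat.factorial i : ℝ))) t := by
  have h := ((((hasDerivAt_id t).mul_const c).pow (i + 1)).div_const (Nat.factorial (i + 1) : ℝ))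
  refine h.congr_deriv ?_
  have h1 : (Nat.factorial i : ℝ) ≠ 0 := by positivity
  have h2 : ((i : ℝ) + 1) ≠ 0 := by positivity
  simp only [Nat.factorial_succ, id]
  push_cast
  field_simp

theorem bnd16_deriv (C : ℝ) (k : ℕ) (t : ℝ) :
    HasDerivAt (bnd16 C (k + 1)) (C * bnd16 C k t) t := by
  have h1 : HasDerivAt (fun t : ℝ => ∑ i ∈ Finset.range k,
      (t * (2 * C)) ^ (i + 1) / (Nat.factorial (i + 1) : ℝ))
      (∑ i ∈ Finset.range k, (2 * C) * ((t * (2 * C)) ^ i / (Nat.factorial i : ℝ))) t :=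
    HasDerivAt.fun_sum fun i _ => bnd16_term (2 * C) i t
  have h2 := ((h1.add_const 1).const_mul (C * 2 / 2 ^ (k + 1))).add
    ((bnd16_term C k t).const_mul C)
  have e : bnd16 C (k + 1) = (fun t : ℝ => C * 2 / 2 ^ (k + 1) * ((∑ i ∈ Finset.range k,
      (t * (2 * C)) ^ (i + 1) / (Nat.factorial (i + 1) : ℝ)) + 1)) +
      (fun t : ℝ => C * ((t * C) ^ (k + 1) / (Nat.factorial (k + 1) : ℝ))) := by
    funext s
    have e1 : 2 * s * C = s * (2 * C) := by ring
    simp only [bnd16, Pi.add_apply, Finset.sum_range_succ' _ k, e1, mul_div_assoc]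
    simp
  rw [e]
  refine h2.congr_deriv ?_
  have e1 : 2 * t * C = t * (2 * C) := by ring
  rw [bnd16, ← Finset.mul_sum, e1, pow_succ]
  field_simp

theorem bnd16_zero (C : ℝ) (k : ℕ) : bnd16 C (k + 1) 0 = C * (1 / 2 ^ k) := by
  simp only [bnd16, Finset.sum_range_succ' _ k]
  simp [pow_succ]
  field_simp

theorem bnd16_cont (C : ℝ) (k : ℕ) : Continuous (bnd16 C k) := by
  unfold bnd16
  fun_prop

theorem bnd16_mono (C : ℝ) (hC : 0 < C) (k : ℕ) {s t : ℝ} (hs : 0 ≤ s) (h : s ≤ t) :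
    bnd16 C k s ≤ bnd16 C k t := by
  unfold bnd16
  gcongr

theorem bnd16_tendsto (C T : ℝ) (hC : 0 < C) (hT : 0 < T) :
    Filter.Tendsto (fun k => bnd16 C k T) Filter.atTop (nhds 0) := by
  have h1 : Filter.Tendsto (fun k : ℕ => C * 2 * Real.exp (2 * T * C) * (1 / 2 : ℝ) ^ k +
      C * ((T * C) ^ k / (Nat.factorial k : ℝ))) Filter.atTop (nhds 0) := by
    have a := (tendsto_pow_atTop_nhds_zero_of_lt_one (r := (1 / 2 : ℝ)) (by norm_num)
      (by norm_num)).const_mul (C * 2 * Real.exp (2 * T * C))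
    have b := (FloorSemiring.tendsto_pow_div_factorial_atTop (T * C)).const_mul C
    simpa using a.add b
  refine squeeze_zero (fun k => ?_) (fun k => ?_) h1
  · unfold bnd16; positivity
  · have := Real.sum_le_exp_of_nonneg (x := 2 * T * C) (by positivity) k
    unfold bnd16
    have e : C * 2 * Real.exp (2 * T * C) * (1 / 2 : ℝ) ^ k
        = C * 2 / 2 ^ k * Real.exp (2 * T * C) := by
      rw [one_div, inv_pow]; field_simp
    rw [e, mul_div_assoc C ((T * C) ^ k)]
    gcongr

/-- Iteration lemma: if `V₀ ≤ C_T` on `[0,T]` and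
`V_{k+1}(t) ≤ C_T (2^{-k} + ∫₀^t V_k)`, then
`V_{k+1}(t) ≤ 2^{-k} C_T Σ_{i=0}^k (2 T C_T)^i/i! + C_T (T C_T)^{k+1}/(k+1)!`,
and consequently `sup_{[0,T]} V_k → 0` as `k → ∞`. -/
theorem stmt16 (T CT : ℝ) (hT : 0 < T) (hCT : 0 < CT)
    (V : ℕ → ℝ → ℝ)
    (hcont : ∀ k, ContinuousOn (V k) (Set.Icc 0 T))
    (hnonneg : ∀ k, ∀ t ∈ Set.Icc (0 : ℝ) T, 0 ≤ V k t)
    (h0 : ∀ t ∈ Set.Icc (0 : ℝ) T, V 0 t ≤ CT)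
    (hrec : ∀ k, ∀ t ∈ Set.Icc (0 : ℝ) T,
      V (k + 1) t ≤ CT * ((2 : ℝ) ^ (-(k : ℤ)) + ∫ τ in (0 : ℝ)..t, V k τ)) :
    (∀ k, ∀ t ∈ Set.Icc (0 : ℝ) T,
      V (k + 1) t ≤
        (2 : ℝ) ^ (-(k : ℤ)) * CT *
            (∑ i ∈ Finset.range (k + 1), (2 * T * CT) ^ i / (Nat.factorial i : ℝ)) +
          CT * (T * CT) ^ (k + 1) / (Nat.factorial (k + 1) : ℝ)) ∧
    Filter.Tendsto (fun k => ⨆ t ∈ Set.Icc (0 : ℝ) T, V k t) Filter.atTop (nhds 0) := by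
  have key : ∀ k, ∀ t ∈ Set.Icc (0 : ℝ) T, V k t ≤ bnd16 CT k t := by
    intro k
    induction k with
    | zero => intro t ht; simpa [bnd16] using h0 t ht
    | succ k ih =>
      intro t ht
      have hsub : Set.Icc 0 t ⊆ Set.Icc 0 T := Set.Icc_subset_Icc_right ht.2
      have hi : ∫ τ in (0 : ℝ)..t, V k τ ≤ ∫ τ in (0 : ℝ)..t, bnd16 CT k τ := by
        refine intervalIntegral.integral_mono_on ht.1 ?_ ?_ fun s hs => ih s (hsub hs)
        · refine ContinuousOn.intervalIntegrable ?_
          rw [Set.uIcc_of_le ht.1]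
          exact (hcont k).mono hsub
        · exact (bnd16_cont CT k).intervalIntegrable _ _
      have hf : ∫ τ in (0 : ℝ)..t, CT * bnd16 CT k τ = bnd16 CT (k + 1) t - bnd16 CT (k + 1) 0 :=
        intervalIntegral.integral_eq_sub_of_hasDerivAt (fun s _ => bnd16_deriv CT k s)
          ((continuous_const.mul (bnd16_cont CT k)).intervalIntegrable _ _)
      rw [intervalIntegral.integral_const_mul, bnd16_zero] at hf
      have hr := hrec k t ht
      rw [zpow_neg, zpow_natCast, ← one_div] at hr
      have := mul_le_mul_of_nonneg_left hi hCT.le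
      linarith
  have key2 : ∀ k, ∀ t ∈ Set.Icc (0 : ℝ) T, V k t ≤ bnd16 CT k T := fun k t ht =>
    (key k t ht).trans (bnd16_mono CT hCT k ht.1 ht.2)
  refine ⟨fun k t ht => ?_, ?_⟩
  · refine (key2 (k + 1) t ht).trans (le_of_eq ?_)
    have e : CT * 2 / 2 ^ (k + 1) = (2 : ℝ) ^ (-(k : ℤ)) * CT := by
      rw [zpow_neg, zpow_natCast, pow_succ]; field_simp
    rw [bnd16, e]
  · refine squeeze_zero (fun k => ?_) (fun k => ?_) (bnd16_tendsto CT T hCT hT)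
    · exact Real.iSup_nonneg fun t => Real.iSup_nonneg fun ht => hnonneg k t ht
    · have hb : 0 ≤ bnd16 CT k T := by unfold bnd16; positivity
      exact Real.iSup_le (fun t => Real.iSup_le (fun ht => key2 k t ht) hb) hb
end

section
/- Let C > 0, z₀ > 0, and a ≥ 0. Define T* = 1/(8 C z₀) if a = 0, and T* = min{ 1/(8 C z₀), 1/(4 C a) } if a > 0. Then for every t ∈ [0, T*): z₀ / √(1 − 8 C z₀ t) + (C / √(1 − 8 C z₀ t)) · ∫₀^t ( 4 z₀² / (1 − 8 C z₀ τ)^{3/2} + 2 z₀ a / (1 − 8 C z₀ τ)^{1/2} ) dτ ≤ 2 z₀ / (1 − 8 C z₀ t). -/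
/-- The explicit induction-step estimate in the uniform a priori bound
for the Friedrichs approximation scheme: with `Tstar = 1/(8 C z₀)` if `a = 0` and
`Tstar = min (1/(8 C z₀)) (1/(4 C a))` otherwise, for every `t ∈ [0, Tstar)` one has
`z₀/√(1 - 8 C z₀ t) + (C/√(1 - 8 C z₀ t)) ∫₀^t (4 z₀²/(1-8 C z₀ τ)^{3/2}
 + 2 z₀ a/(1-8 C z₀ τ)^{1/2}) dτ ≤ 2 z₀/(1 - 8 C z₀ t)`. -/
theorem stmt17 (C z₀ a Tstar : ℝ) (hC : 0 < C) (hz : 0 < z₀) (ha : 0 ≤ a)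
    (hTstar : Tstar = if a = 0 then 1 / (8 * C * z₀)
      else min (1 / (8 * C * z₀)) (1 / (4 * C * a))) :
    ∀ t ∈ Set.Ico (0 : ℝ) Tstar,
      z₀ / Real.sqrt (1 - 8 * C * z₀ * t) +
        (C / Real.sqrt (1 - 8 * C * z₀ * t)) *
          ∫ τ in (0 : ℝ)..t,
            (4 * z₀ ^ 2 / (1 - 8 * C * z₀ * τ) ^ ((3 : ℝ) / 2) +
              2 * z₀ * a / (1 - 8 * C * z₀ * τ) ^ ((1 : ℝ) / 2)) ≤
      2 * z₀ / (1 - 8 * C * z₀ * t) := by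
  intro t ht
  obtain ⟨ht0, htT⟩ := ht
  have hk : 0 < 8 * C * z₀ := by positivity
  have h1 : t < 1 / (8 * C * z₀) := by
    rw [hTstar] at htT
    split_ifs at htT
    · exact htT
    · exact lt_of_lt_of_le htT (min_le_left _ _)
  have h2 : 4 * C * a * t ≤ 1 := by
    rw [hTstar] at htT
    split_ifs at htT with h
    · simp [h]
    · have hapos : 0 < a := lt_of_le_of_ne ha (Ne.symm h)
      have h3 : t < 1 / (4 * C * a) := lt_of_lt_of_le htT (min_le_right _ _)
      rw [lt_div_iff₀ (by positivity)] at h3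
      linarith
  rw [lt_div_iff₀ hk] at h1
  have hpos : ∀ τ ∈ Set.uIcc 0 t, 0 < 1 - 8 * C * z₀ * τ := by
    intro τ hτ
    rw [Set.uIcc_of_le ht0] at hτ
    have := mul_le_mul_of_nonneg_left hτ.2 hk.le
    linarith
  have hint : ∫ τ in (0 : ℝ)..t,
            (4 * z₀ ^ 2 / (1 - 8 * C * z₀ * τ) ^ ((3 : ℝ) / 2) +
              2 * z₀ * a / (1 - 8 * C * z₀ * τ) ^ ((1 : ℝ) / 2)) =
      ((z₀ / C) * (Real.sqrt (1 - 8 * C * z₀ * t))⁻¹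
          - a / (2 * C) * Real.sqrt (1 - 8 * C * z₀ * t)) -
      ((z₀ / C) * (Real.sqrt (1 - 8 * C * z₀ * 0))⁻¹
          - a / (2 * C) * Real.sqrt (1 - 8 * C * z₀ * 0)) := by
    apply intervalIntegral.integral_eq_sub_of_hasDerivAt
      (f := fun τ => (z₀ / C) * (Real.sqrt (1 - 8 * C * z₀ * τ))⁻¹
          - a / (2 * C) * Real.sqrt (1 - 8 * C * z₀ * τ))
    · intro τ hτ
      have hp := hpos τ hτ
      have hs : 0 < Real.sqrt (1 - 8 * C * z₀ * τ) := Real.sqrt_pos.2 hp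
      have hl : HasDerivAt (fun τ : ℝ => 1 - 8 * C * z₀ * τ) (-(8 * C * z₀)) τ := by
        simpa using ((hasDerivAt_id τ).const_mul (8 * C * z₀)).const_sub 1
      have hd := hl.sqrt hp.ne'
      have hd2 := ((hd.inv hs.ne').const_mul (z₀ / C)).sub (hd.const_mul (a / (2 * C)))
      refine hd2.congr_deriv ?_
      have e3 : (1 - 8 * C * z₀ * τ) ^ ((3 : ℝ) / 2) = Real.sqrt (1 - 8 * C * z₀ * τ) ^ 3 := by
        rw [Real.sqrt_eq_rpow, ← Real.rpow_natCast, ← Real.rpow_mul hp.le]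
        norm_num
      rw [e3, ← Real.sqrt_eq_rpow]
      generalize Real.sqrt (1 - 8 * C * z₀ * τ) = s at hs
      field_simp
      ring
    · apply ContinuousOn.intervalIntegrable
      have hc : ContinuousOn (fun τ : ℝ => 1 - 8 * C * z₀ * τ) (Set.uIcc 0 t) := by fun_prop
      refine ContinuousOn.add (ContinuousOn.div continuousOn_const
        (hc.rpow_const fun x hx => Or.inl (hpos x hx).ne') ?_)
        (ContinuousOn.div continuousOn_const
        (hc.rpow_const fun x hx => Or.inl (hpos x hx).ne') ?_)
      · exact fun x hx => (Real.rpow_pos_of_pos (hpos x hx) _).ne'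
      · exact fun x hx => (Real.rpow_pos_of_pos (hpos x hx) _).ne'
  rw [hint]
  have hp : 0 < 1 - 8 * C * z₀ * t := by linarith
  have hs : 0 < Real.sqrt (1 - 8 * C * z₀ * t) := Real.sqrt_pos.2 hp
  have hsq := Real.sq_sqrt hp.le
  have hs1 : Real.sqrt (1 - 8 * C * z₀ * t) ≤ 1 := by
    rw [Real.sqrt_le_one]
    have := mul_nonneg hk.le ht0
    linarith
  simp only [mul_zero, sub_zero, Real.sqrt_one, inv_one, mul_one]
  have hden : 2 * z₀ / (1 - 8 * C * z₀ * t) = 2 * z₀ / Real.sqrt (1 - 8 * C * z₀ * t) ^ 2 := by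
    rw [hsq]
  rw [hden]
  generalize Real.sqrt (1 - 8 * C * z₀ * t) = s at hs hsq hs1
  have key : a * s * (1 - s) ≤ 2 * z₀ := by
    have e1 : a * (1 - s ^ 2) ≤ 2 * z₀ := by
      rw [hsq]
      nlinarith
    nlinarith [mul_nonneg ha (sub_nonneg.2 hs1)]
  have e : 2 * z₀ / s ^ 2 - (z₀ / s + C / s * (z₀ / C * s⁻¹ - a / (2 * C) * s - (z₀ / C - a / (2 * C))))
      = (2 * z₀ - a * s * (1 - s)) / (2 * s ^ 2) := by
    field_simp
    ring
  have : 0 ≤ (2 * z₀ - a * s * (1 - s)) / (2 * s ^ 2) :=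
    div_nonneg (by linarith) (by positivity)
  linarith
end
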